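/- Let φ, m ∈ C_0^∞(ℝ^{2d}) with φ real-valued, and assume that the d×d matrix ∇_ξ(∇_η − ∇_ξ)φ, with entries ∂_{ξ_i}(∂_{η_j} − ∂_{ξ_j})φ, is invertible at every point of supp m. Then there exists a constant C such that for all λ ≠ 0 and all Schwartz functions f, g on ℝ^d, ‖B_λ(f,g)‖_{L^2} ≤ C |λ|^{−d/2} ‖f‖_{L^2} ‖g‖_{L^1}. -/

import Mathlib

open MeasureTheory Filter Complex SchwartzMap
open scoped RealInnerProductSpace ENNReal

noncomputable section

/-- Euclidean space `ℝ^d`. -/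
abbrev E (d : ℕ) : Type := EuclideanSpace ℝ (Fin d)

/-- The Fourier transform `(2π)^{-d/2} ∫ e^{-i x·ξ} f(x) dx`. -/
def FT {d : ℕ} (f : E d → ℂ) (ξ : E d) : ℂ :=
  (((2 * Real.pi) ^ (-(d : ℝ) / 2) : ℝ) : ℂ) *
    ∫ x : E d, Complex.exp (-(Complex.I * ((⟪x, ξ⟫ : ℝ) : ℂ))) * f x

/-- The bilinear oscillatory integral `B_λ(f,g)` with symbol `m` and phase `φ`. -/
def Bop {d : ℕ} (m : E d × E d → ℂ) (φ : E d × E d → ℝ) (lam : ℝ)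
    (f g : 𝓢(E d, ℂ)) (x : E d) : ℂ :=
  (((2 * Real.pi) ^ (-(d : ℝ) / 2) : ℝ) : ℂ) *
    ∫ p : E d × E d,
      Complex.exp (Complex.I * ((⟪x, p.1 + p.2⟫ + lam * φ p : ℝ) : ℂ)) *
        m p * FT (⇑f) p.1 * FT (⇑g) p.2

/-- Standard basis vector of `ℝ^d`. -/
def ev {d : ℕ} (i : Fin d) : E d := EuclideanSpace.single i 1

/-- The direction corresponding to `∂_{η_i}`. -/
def etaV {d : ℕ} (i : Fin d) : E d × E d := (ev i, 0)

/-- The direction corresponding to `∂_{ξ_i}`. -/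
def xiV {d : ℕ} (i : Fin d) : E d × E d := (0, ev i)

/-- Iterated (second) directional derivative: first in direction `u`, then in direction `v`. -/
def D2 {V : Type*} [NormedAddCommGroup V] [NormedSpace ℝ V]
    (φ : V → ℝ) (x u v : V) : ℝ :=
  fderiv ℝ (fun y => fderiv ℝ φ y u) x v

/-- The full `2d × 2d` Hessian matrix of `φ` at `x` in the variables `(η,ξ)`. -/
def hessMat {d : ℕ} (φ : E d × E d → ℝ) (x : E d × E d) :
    Matrix (Fin d ⊕ Fin d) (Fin d ⊕ Fin d) ℝ :=
  Matrix.of fun i j => D2 φ x (Sum.elim etaV xiV j) (Sum.elim etaV xiV i)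

/-- The `d × d` matrix `(A_i B_j φ)_{i,j}` for families of first-order directions `A`, `B`. -/
def derMat {d : ℕ} (φ : E d × E d → ℝ) (x : E d × E d)
    (A B : Fin d → E d × E d) : Matrix (Fin d) (Fin d) ℝ :=
  Matrix.of fun i j => D2 φ x (B j) (A i)

/-- Smoothness of parametric integrals over compact sets (finite order). -/
lemma contDiff_setIntegral_nat {X Y : Type} [NormedAddCommGroup X] [NormedSpace ℝ X]
    [FiniteDimensional ℝ X] [NormedAddCommGroup Y] [NormedSpace ℝ Y] [FiniteDimensional ℝ Y]
    [MeasurableSpace Y] [BorelSpace Y]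
    (μ : Measure Y) [IsFiniteMeasureOnCompacts μ] {K : Set Y} (hK : IsCompact K) (n : ℕ) :
    ∀ (Z : Type) [NormedAddCommGroup Z] [NormedSpace ℝ Z] [CompleteSpace Z] (G : X × Y → Z),
      ContDiff ℝ (⊤ : ℕ∞) G → ContDiff ℝ n (fun x => ∫ y in K, G (x, y) ∂μ) := by
  haveI : ProperSpace X := FiniteDimensional.proper ℝ X
  have hfin : IsFiniteMeasure (μ.restrict K) := ⟨by simpa using hK.measure_lt_top⟩
  induction n with
  | zero =>
    intro Z _ _ _ G hG
    simp only [Nat.cast_zero, contDiff_zero]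
    exact continuous_parametric_integral_of_continuous (f := fun x y => G (x, y)) hG.continuous hK
  | succ n ih =>
    intro Z _ _ _ G hG
    push_cast
    rw [contDiff_succ_iff_hasFDerivAt]
    have hG1 : ContDiff ℝ (⊤ : ℕ∞)
        (fun q : X × Y => (fderiv ℝ G q).comp (ContinuousLinearMap.inl ℝ X Y)) := by
      have : ContDiff ℝ (⊤ : ℕ∞) (fderiv ℝ G) := hG.fderiv_right (by simp)
      exact this.clm_comp contDiff_const
    refine ⟨fun x => ∫ y in K, (fderiv ℝ G (x, y)).comp (ContinuousLinearMap.inl ℝ X Y) ∂μ,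
      ih _ _ hG1, fun x => ?_⟩
    have hcont : Continuous (fun q : X × Y => (fderiv ℝ G q).comp (ContinuousLinearMap.inl ℝ X Y)) :=
      hG1.continuous
    obtain ⟨C, hC⟩ := ((isCompact_closedBall x 1).prod hK).exists_bound_of_continuousOn
      hcont.continuousOn
    refine hasFDerivAt_integral_of_dominated_of_fderiv_le (F := fun x y => G (x, y))
      (F' := fun x y => (fderiv ℝ G (x, y)).comp (ContinuousLinearMap.inl ℝ X Y))
      (s := Metric.closedBall x 1) (bound := fun _ => C)
      (Metric.closedBall_mem_nhds x one_pos) ?_ ?_ ?_ ?_ ?_ ?_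
    · refine Eventually.of_forall fun x' => ?_
      exact (hG.continuous.comp (by fun_prop : Continuous fun y : Y => (x', y))).aestronglyMeasurable
    · have : Continuous fun y : Y => G (x, y) :=
        hG.continuous.comp (by fun_prop : Continuous fun y : Y => (x, y))
      exact this.continuousOn.integrableOn_compact hK
    · exact (hcont.comp (by fun_prop : Continuous fun y : Y => (x, y))).aestronglyMeasurable
    · filter_upwards [ae_restrict_mem hK.measurableSet] with y hy x' hx'
      exact hC (x', y) ⟨hx', hy⟩
    · exact integrable_const C
    · refine Eventually.of_forall fun y x' _ => ?_
      have h1 : HasFDerivAt G (fderiv ℝ G (x', y)) (x', y) :=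
        (hG.differentiable (by simp) _).hasFDerivAt
      exact h1.comp x' (hasFDerivAt_prodMk_left x' y)

/-- Smoothness of parametric integrals over compact sets. -/
lemma contDiff_setIntegral {X Y : Type} [NormedAddCommGroup X] [NormedSpace ℝ X]
    [FiniteDimensional ℝ X] [NormedAddCommGroup Y] [NormedSpace ℝ Y] [FiniteDimensional ℝ Y]
    [MeasurableSpace Y] [BorelSpace Y]
    (μ : Measure Y) [IsFiniteMeasureOnCompacts μ] {K : Set Y} (hK : IsCompact K)
    {Z : Type} [NormedAddCommGroup Z] [NormedSpace ℝ Z] [CompleteSpace Z] (G : X × Y → Z)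
    (hG : ContDiff ℝ (⊤ : ℕ∞) G) : ContDiff ℝ (⊤ : ℕ∞) (fun x => ∫ y in K, G (x, y) ∂μ) := by
  rw [contDiff_infty]
  intro n
  exact contDiff_setIntegral_nat μ hK n Z G hG

/-- slices of compactly supported functions -/
lemma hasCompactSupport_slice {X Y Z : Type*} [TopologicalSpace X] [TopologicalSpace Y]
    [T2Space X] [T2Space Y] [Zero Z] {G : X × Y → Z} (h : HasCompactSupport G) (p : Y) :
    HasCompactSupport (fun x => G (x, p)) := by
  refine HasCompactSupport.intro (h.isCompact.image continuous_fst) fun x hx => ?_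
  by_contra hne
  exact hx ⟨(x, p), subset_tsupport _ hne, rfl⟩

/-- slice derivative -/
lemma fderiv_slice {X Y Z : Type*} [NormedAddCommGroup X] [NormedSpace ℝ X]
    [NormedAddCommGroup Y] [NormedSpace ℝ Y] [NormedAddCommGroup Z] [NormedSpace ℝ Z]
    {G : X × Y → Z} (x : X) (y : Y) (h : DifferentiableAt ℝ G (x, y)) (v : X) :
    fderiv ℝ (fun x => G (x, y)) x v = fderiv ℝ G (x, y) (v, 0) := by
  have h1 := h.hasFDerivAt.comp x (hasFDerivAt_prodMk_left (𝕜 := ℝ) x y)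
  have h2 : HasFDerivAt (fun x => G (x, y)) _ x := h1
  rw [h2.fderiv]
  simp

/-- Non-stationary phase with parameters. -/
lemma nonstat {d : ℕ} {P : Type*} [NormedAddCommGroup P] [NormedSpace ℝ P]
    (F : E d × P → ℝ) (hF : ContDiff ℝ (⊤ : ℕ∞) F) (N : ℕ) :
    ∀ (b : E d × P → ℂ), ContDiff ℝ (⊤ : ℕ∞) b → HasCompactSupport b →
      (∀ q ∈ tsupport b, ∃ i, fderiv ℝ F q (ev i, 0) ≠ 0) →
      ∃ C : ℝ, ∀ (μ : ℝ) (p : P),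
        |μ| ^ N * ‖∫ ζ, Complex.exp (Complex.I * ((μ * F (ζ, p) : ℝ) : ℂ)) * b (ζ, p)‖ ≤ C := by
  induction N with
  | zero =>
    intro b hb hbc _
    obtain ⟨C, hC⟩ := hbc.exists_bound_of_continuous hb.continuous
    have hK : IsCompact (Prod.fst '' tsupport b) := hbc.isCompact.image continuous_fst
    refine ⟨C * (volume (Prod.fst '' tsupport b)).toReal, fun μ p => ?_⟩
    simp only [pow_zero, one_mul]
    rw [← setIntegral_eq_integral_of_forall_compl_eq_zero (s := Prod.fst '' tsupport b)]
    · refine norm_setIntegral_le_of_norm_le_const hK.measure_lt_top ?_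
      intro x _
      rw [norm_mul, mul_comm Complex.I, Complex.norm_exp_ofReal_mul_I, one_mul]
      exact hC _
    · intro x hx
      have : b (x, p) = 0 := by
        by_contra hne
        exact hx ⟨(x, p), subset_tsupport _ hne, rfl⟩
      simp [this]
  | succ N ih =>
    intro b hb hbc hne
    -- gradient squared
    let S : E d × P → ℝ := fun q => ∑ i : Fin d, (fderiv ℝ F q (ev i, 0)) ^ 2
    have hdF : ∀ i : Fin d, ContDiff ℝ (⊤ : ℕ∞) (fun q => fderiv ℝ F q (ev i, 0)) := fun i =>
      (hF.fderiv_right (by simp)).clm_apply contDiff_const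
    have hS : ContDiff ℝ (⊤ : ℕ∞) S := ContDiff.sum fun i _ => (hdF i).pow 2
    have hSne : ∀ q ∈ tsupport b, S q ≠ 0 := by
      intro q hq h0
      obtain ⟨i, hi⟩ := hne q hq
      have := (Finset.sum_eq_zero_iff_of_nonneg (fun i _ => sq_nonneg (fderiv ℝ F q (ev i, 0)))).1 h0
        i (Finset.mem_univ i)
      exact hi (by simpa using this)
    let c : Fin d → E d × P → ℂ := fun i q => ((fderiv ℝ F q (ev i, 0) / S q : ℝ) : ℂ) * b q
    have hcs : ∀ i, tsupport (c i) ⊆ tsupport b := fun i => closure_mono fun q hq => by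
      intro h0
      exact hq (by simp [c, h0])
    have hc : ∀ i, ContDiff ℝ (⊤ : ℕ∞) (c i) := by
      intro i
      rw [contDiff_iff_contDiffAt]
      intro q
      by_cases hq : q ∈ tsupport b
      · exact (Complex.ofRealCLM.contDiff.contDiffAt.comp q
          ((hdF i).contDiffAt.div hS.contDiffAt (hSne q hq))).mul hb.contDiffAt
      · have : c i =ᶠ[nhds q] fun _ => 0 := by
          have := notMem_tsupport_iff_eventuallyEq.1 hq
          filter_upwards [this] with q' hq'
          simp [c, hq']
        exact contDiffAt_const.congr_of_eventuallyEq this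
    have hcc : ∀ i, HasCompactSupport (c i) := fun i =>
      hbc.of_isClosed_subset (isClosed_tsupport _) (hcs i)
    let b' : Fin d → E d × P → ℂ := fun i q => fderiv ℝ (c i) q (ev i, 0)
    have hb's : ∀ i, tsupport (b' i) ⊆ tsupport (c i) := fun i =>
      (tsupport_fderiv_apply_subset ℝ (ev i, (0 : P)))
    have key : ∀ i, ∃ C : ℝ, ∀ (μ : ℝ) (p : P),
        |μ| ^ N * ‖∫ ζ, Complex.exp (Complex.I * ((μ * F (ζ, p) : ℝ) : ℂ)) * b' i (ζ, p)‖ ≤ C := by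
      intro i
      refine ih (b' i) (((hc i).fderiv_right (by simp)).clm_apply contDiff_const) ?_ ?_
      · exact (hcc i).of_isClosed_subset (isClosed_tsupport _) (hb's i)
      · exact fun q hq => hne q (hcs i (hb's i hq))
    choose C hC using key
    refine ⟨∑ i, C i, fun μ p => ?_⟩
    by_cases hμ : μ = 0
    · have h0 : ∀ i, 0 ≤ C i := fun i => le_trans (by positivity) (hC i μ p)
      simp [hμ]
      exact Finset.sum_nonneg fun i _ => h0 i
    -- exponentials
    let e : E d → ℂ := fun ζ => Complex.exp (Complex.I * ((μ * F (ζ, p) : ℝ) : ℂ))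
    have hFs : ContDiff ℝ (⊤ : ℕ∞) (fun ζ => F (ζ, p)) := hF.comp (contDiff_prodMk_left p)
    have he : ContDiff ℝ (⊤ : ℕ∞) e := by
      apply ContDiff.cexp
      exact contDiff_const.mul (Complex.ofRealCLM.contDiff.comp (contDiff_const.mul hFs))
    have hde : ∀ ζ (i : Fin d), fderiv ℝ e ζ (ev i) =
        Complex.I * μ * (fderiv ℝ F (ζ, p) (ev i, 0) : ℝ) * e ζ := by
      intro ζ i
      have h1 : HasFDerivAt (fun ζ => F (ζ, p)) (fderiv ℝ (fun ζ => F (ζ, p)) ζ) ζ :=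
        (hFs.differentiable (by simp) ζ).hasFDerivAt
      have h2 := ((Complex.ofRealCLM.hasFDerivAt.comp ζ (h1.const_mul μ)).const_mul Complex.I).cexp
      have h3 : HasFDerivAt e _ ζ := h2
      rw [h3.fderiv, ← fderiv_slice ζ p (hF.differentiable (by simp) _)]
      simp [e]
      ring
    have hcsl : ∀ i, ContDiff ℝ (⊤ : ℕ∞) (fun ζ => c i (ζ, p)) := fun i =>
      (hc i).comp (contDiff_prodMk_left p)
    have hccsl : ∀ i, HasCompactSupport (fun ζ => c i (ζ, p)) := fun i =>
      hasCompactSupport_slice (hcc i) p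
    have ibp : ∀ i, ∫ ζ, e ζ * b' i (ζ, p) =
        - ∫ ζ, Complex.I * μ * (fderiv ℝ F (ζ, p) (ev i, 0) : ℝ) * e ζ * c i (ζ, p) := by
      intro i
      have := integral_mul_fderiv_eq_neg_fderiv_mul_of_integrable (μ := (volume : Measure (E d)))
        (f := e) (g := fun ζ => c i (ζ, p)) (v := ev i) ?_ ?_ ?_ ?_ ?_
      · simp only [hde] at this
        rw [← this]
        congr 1
        ext ζ
        rw [fderiv_slice ζ p ((hc i).differentiable (by simp) _)]
      · refine Continuous.integrable_of_hasCompactSupport ?_ ?_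
        · exact (((he.fderiv_right (m := (⊤ : ℕ∞)) (by simp)).clm_apply contDiff_const).mul
            (hcsl i)).continuous
        · exact (hccsl i).mul_left
      · refine Continuous.integrable_of_hasCompactSupport ?_ ?_
        · exact (he.mul (((hcsl i).fderiv_right (m := (⊤ : ℕ∞)) (by simp)).clm_apply
            contDiff_const)).continuous
        · exact ((hccsl i).fderiv_apply ℝ (ev i)).mul_left
      · refine Continuous.integrable_of_hasCompactSupport (he.mul (hcsl i)).continuous ?_
        exact (hccsl i).mul_left
      · exact fun x _ => he.differentiable (by simp) x
      · exact fun x _ => (hcsl i).differentiable (by simp) x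
    have hIntg : ∀ i, Integrable
        (fun ζ => Complex.I * μ * (fderiv ℝ F (ζ, p) (ev i, 0) : ℝ) * e ζ * c i (ζ, p)) := by
      intro i
      refine Continuous.integrable_of_hasCompactSupport ?_ (hccsl i).mul_left
      have h1 : Continuous fun ζ => fderiv ℝ F (ζ, p) (ev i, 0) :=
        (hdF i).continuous.comp (by fun_prop : Continuous fun ζ : E d => (ζ, p))
      exact ((continuous_const.mul (Complex.continuous_ofReal.comp h1)).mul he.continuous).mul
        (hcsl i).continuous
    have hsum : ∑ i, ∫ ζ, e ζ * b' i (ζ, p) = - (Complex.I * μ * ∫ ζ, e ζ * b (ζ, p)) := by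
      simp_rw [ibp]
      rw [Finset.sum_neg_distrib, ← integral_finset_sum _ fun i _ => hIntg i, ← integral_const_mul]
      congr 2
      ext ζ
      by_cases hz : b (ζ, p) = 0
      · simp [c, hz]
      have hs : S (ζ, p) ≠ 0 := hSne _ (subset_tsupport _ hz)
      have hs' : (S (ζ, p) : ℂ) ≠ 0 := by exact_mod_cast hs
      have h4 : ∑ i : Fin d, ((fderiv ℝ F (ζ, p) (ev i, 0) : ℝ) : ℂ) ^ 2 = (S (ζ, p) : ℂ) := by
        simp [S]
      calc _ = ∑ i : Fin d, ((fderiv ℝ F (ζ, p) (ev i, 0) : ℝ) : ℂ) ^ 2 *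
            (Complex.I * μ * e ζ * b (ζ, p) / (S (ζ, p) : ℂ)) := by
            refine Finset.sum_congr rfl fun i _ => ?_
            simp only [c, Complex.ofReal_div]
            ring
        _ = _ := by
            rw [← Finset.sum_mul, h4]
            field_simp
    calc |μ| ^ (N + 1) * ‖∫ ζ, e ζ * b (ζ, p)‖
        = |μ| ^ N * ‖∑ i, ∫ ζ, e ζ * b' i (ζ, p)‖ := by
          rw [hsum, norm_neg, norm_mul, norm_mul]
          simp
          ring
      _ ≤ |μ| ^ N * ∑ i, ‖∫ ζ, e ζ * b' i (ζ, p)‖ := by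
          gcongr
          exact norm_sum_le _ _
      _ = ∑ i, |μ| ^ N * ‖∫ ζ, e ζ * b' i (ζ, p)‖ := Finset.mul_sum _ _ _
      _ ≤ _ := Finset.sum_le_sum fun i _ => hC i μ p

/-- Smooth cutoff function adapted to a compact subset of an open set. -/
lemma exists_cutoff {X : Type*} [NormedAddCommGroup X] [NormedSpace ℝ X] [FiniteDimensional ℝ X]
    {K U : Set X} (hK : IsCompact K) (hU : IsOpen U) (hKU : K ⊆ U) :
    ∃ χ : X → ℝ, ContDiff ℝ (⊤ : ℕ∞) χ ∧ HasCompactSupport χ ∧ tsupport χ ⊆ U ∧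
      ∃ V, IsOpen V ∧ K ⊆ V ∧ ∀ x ∈ V, χ x = 1 := by
  have : ProperSpace X := FiniteDimensional.proper ℝ X
  obtain ⟨t, ht, hKt, htU⟩ := exists_compact_between hK hU hKU
  obtain ⟨f, hf1, hf0, -⟩ := exists_contMDiffMap_one_nhds_of_subset_interior (n := (⊤ : ℕ∞))
    (modelWithCornersSelf ℝ X) hK.isClosed hKt
  have hts : tsupport f ⊆ t := by
    refine closure_minimal (fun x hx => ?_) ht.isClosed
    by_contra h
    exact hx (hf0 x h)
  obtain ⟨V, hV, hKV, hVf⟩ := eventually_nhdsSet_iff_exists.1 hf1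
  exact ⟨f, f.contMDiff.contDiff, ht.of_isClosed_subset (isClosed_tsupport _) hts,
    hts.trans htU, V, hV, hKV, hVf⟩

/-- Hadamard-type factor. -/
def hadF {d : ℕ} (Φ : E d × E d → ℝ) (q : E d × (E d × (ℝ × E d))) : ℝ :=
  ∫ t in Set.Icc (0 : ℝ) 1, fderiv ℝ Φ (q.1, q.2.1 + (t * q.2.2.1) • q.2.2.2) (0, q.2.2.2)

lemma hadF_contDiff {d : ℕ} {Φ : E d × E d → ℝ} (hΦ : ContDiff ℝ (⊤ : ℕ∞) Φ) :
    ContDiff ℝ (⊤ : ℕ∞) (hadF Φ) := by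
  refine contDiff_setIntegral (X := E d × (E d × (ℝ × E d))) (Y := ℝ) volume isCompact_Icc
    (fun x => fderiv ℝ Φ (x.1.1, x.1.2.1 + (x.2 * x.1.2.2.1) • x.1.2.2.2) (0, x.1.2.2.2)) ?_
  have h1 : ContDiff ℝ (⊤ : ℕ∞) (fderiv ℝ Φ) := hΦ.fderiv_right (by simp)
  refine ContDiff.clm_apply (h1.comp ?_) ?_
  · fun_prop
  · fun_prop

lemma hadF_zero {d : ℕ} {Φ : E d × E d → ℝ} (ζ η ω : E d) :
    hadF Φ (ζ, (η, (0, ω))) = fderiv ℝ Φ (ζ, η) (0, ω) := by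
  simp [hadF]

lemma hadF_mul {d : ℕ} {Φ : E d × E d → ℝ} (hΦ : ContDiff ℝ (⊤ : ℕ∞) Φ) (ζ η ω : E d) (r : ℝ) :
    r * hadF Φ (ζ, (η, (r, ω))) = Φ (ζ, η + r • ω) - Φ (ζ, η) := by
  have h1 : ∀ t : ℝ, HasDerivAt (fun t : ℝ => Φ (ζ, η + (t * r) • ω))
      (r * fderiv ℝ Φ (ζ, η + (t * r) • ω) (0, ω)) t := by
    intro t
    have ha : HasFDerivAt Φ _ (ζ, η + (t * r) • ω) :=
      (hΦ.differentiable (by simp) _).hasFDerivAt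
    have hb : HasDerivAt (fun t : ℝ => (ζ, η + (t * r) • ω)) ((0 : E d), r • ω) t := by
      refine (hasDerivAt_const t ζ).prodMk ?_
      have := (((hasDerivAt_id t).mul_const r).smul_const ω).const_add η
      simpa using this
    have hc := ha.comp_hasDerivAt t hb
    have e1 : fderiv ℝ Φ (ζ, η + (t * r) • ω) (0, r • ω) =
        r * fderiv ℝ Φ (ζ, η + (t * r) • ω) (0, ω) := by
      have : ((0 : E d), r • ω) = r • ((0 : E d), ω) := by simp
      rw [this, map_smul, smul_eq_mul]
    rw [e1] at hc
    exact hc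
  have hcont : Continuous fun t : ℝ => r * fderiv ℝ Φ (ζ, η + (t * r) • ω) (0, ω) := by
    have h2 : ContDiff ℝ (⊤ : ℕ∞) (fderiv ℝ Φ) := hΦ.fderiv_right (by simp)
    exact continuous_const.mul ((h2.continuous.comp (by fun_prop)).clm_apply continuous_const)
  have h3 := intervalIntegral.integral_eq_sub_of_hasDerivAt (a := 0) (b := 1)
    (fun t _ => h1 t) (hcont.intervalIntegrable _ _)
  simp only [one_mul, zero_mul, zero_smul, add_zero] at h3
  rw [← h3, intervalIntegral.integral_of_le zero_le_one, ← integral_Icc_eq_integral_Ioc,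
    integral_const_mul]
  rfl

/-- Bound on the `T^* T` kernel. -/
lemma kernel_bound {d : ℕ} (Φ : E d × E d → ℝ) (a : E d × E d → ℂ)
    (hΦ : ContDiff ℝ (⊤ : ℕ∞) Φ) (ha : ContDiff ℝ (⊤ : ℕ∞) a) (hac : HasCompactSupport a)
    (hnd : ∀ q ∈ tsupport a, ∀ ω : E d, ω ≠ 0 →
      ∃ i, fderiv ℝ (fun q => fderiv ℝ Φ q (0, ω)) q (ev i, 0) ≠ 0) (N : ℕ) :
    ∃ ε > 0, ∃ C : ℝ, ∀ (lam : ℝ) (η η' : E d), ‖η - η'‖ < ε →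
      (1 + |lam| * ‖η - η'‖) ^ N *
        ‖∫ ζ, Complex.exp (Complex.I * ((lam * (Φ (ζ, η) - Φ (ζ, η')) : ℝ) : ℂ)) *
          (a (ζ, η) * (starRingEnd ℂ) (a (ζ, η')))‖ ≤ C := by
  let F := hadF Φ
  have hF : ContDiff ℝ (⊤ : ℕ∞) F := hadF_contDiff hΦ
  let U : Set (E d × (E d × (ℝ × E d))) := {q | ∃ i, fderiv ℝ F q (ev i, 0) ≠ 0}
  have hU : IsOpen U := by
    have : U = ⋃ i, {q | fderiv ℝ F q (ev i, 0) ≠ 0} := by ext; simp [U]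
    rw [this]
    refine isOpen_iUnion fun i => isOpen_ne_fun ?_ continuous_const
    exact ((hF.fderiv_right (m := (⊤ : ℕ∞)) (by simp)).continuous).clm_apply continuous_const
  let σ : ℝ × ((E d × E d) × E d) → E d × (E d × (ℝ × E d)) :=
    fun x => (x.2.1.1, (x.2.1.2, (x.1, x.2.2)))
  have hσ : Continuous σ := by fun_prop
  let K' : Set ((E d × E d) × E d) := tsupport a ×ˢ Metric.sphere (0 : E d) 1
  have hK' : IsCompact K' := hac.isCompact.prod (isCompact_sphere _ _)
  have hK : IsCompact (σ '' ({0} ×ˢ K')) := (isCompact_singleton.prod hK').image hσ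
  have hKU : σ '' ({0} ×ˢ K') ⊆ U := by
    rintro _ ⟨⟨r, ⟨⟨ζ, η⟩, ω⟩⟩, ⟨hr, hq, hω⟩, rfl⟩
    simp only [Set.mem_singleton_iff] at hr
    subst hr
    have hω0 : ω ≠ 0 := by
      rintro rfl
      simp at hω
    obtain ⟨i, hi⟩ := hnd (ζ, η) hq ω hω0
    refine ⟨i, ?_⟩
    change fderiv ℝ F (ζ, (η, (0, ω))) (ev i, 0) ≠ 0
    rw [← fderiv_slice ζ _ (hF.differentiable (by simp) _)]
    have h1 : (fun ζ => F (ζ, (η, ((0 : ℝ), ω)))) = fun ζ => fderiv ℝ Φ (ζ, η) (0, ω) := by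
      ext ζ
      exact hadF_zero ζ η ω
    rw [h1]
    have h2 : ContDiff ℝ (⊤ : ℕ∞) (fun q => fderiv ℝ Φ q (0, ω)) :=
      (hΦ.fderiv_right (by simp)).clm_apply contDiff_const
    rw [fderiv_slice (G := fun q => fderiv ℝ Φ q (0, ω)) ζ η (h2.differentiable (by simp) _)]
    exact hi
  obtain ⟨χ, hχ, hχc, hχU, V, hV, hKV, hχ1⟩ := exists_cutoff hK hU hKU
  obtain ⟨u, v, hu, hv, hu0, hvK, huv⟩ := generalized_tube_lemma (s := {(0 : ℝ)})
    isCompact_singleton hK' (hV.preimage hσ) (by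
      rintro x hx
      exact hKV ⟨x, hx, rfl⟩)
  obtain ⟨ε, hε, hεu⟩ := Metric.isOpen_iff.1 hu 0 (hu0 rfl)
  let b : E d × (E d × (ℝ × E d)) → ℂ := fun q =>
    (a (q.1, q.2.1 + q.2.2.1 • q.2.2.2) * (starRingEnd ℂ) (a (q.1, q.2.1))) * (χ q : ℂ)
  have hb : ContDiff ℝ (⊤ : ℕ∞) b := by
    refine ContDiff.mul (ContDiff.mul ?_ ?_) ?_
    · exact ha.comp (by fun_prop)
    · exact Complex.conjCLE.contDiff.comp (ha.comp (by fun_prop))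
    · exact Complex.ofRealCLM.contDiff.comp hχ
  have hbs : tsupport b ⊆ tsupport χ := closure_mono fun q hq h0 => hq (by simp [b, h0])
  obtain ⟨C1, hC1⟩ := nonstat F hF N b hb (hχc.of_isClosed_subset (isClosed_tsupport _) hbs)
    (fun q hq => hχU (hbs hq))
  -- trivial bound
  obtain ⟨A, hA⟩ := hac.exists_bound_of_continuous ha.continuous
  have hA0 : 0 ≤ A := le_trans (norm_nonneg _) (hA 0)
  have hKa : IsCompact (Prod.fst '' tsupport a) := hac.isCompact.image continuous_fst
  let C0 := A * A * (volume (Prod.fst '' tsupport a)).toReal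
  have hC0 : ∀ (lam : ℝ) (η η' : E d),
      ‖∫ ζ, Complex.exp (Complex.I * ((lam * (Φ (ζ, η) - Φ (ζ, η')) : ℝ) : ℂ)) *
          (a (ζ, η) * (starRingEnd ℂ) (a (ζ, η')))‖ ≤ C0 := by
    intro lam η η'
    rw [← setIntegral_eq_integral_of_forall_compl_eq_zero (s := Prod.fst '' tsupport a)]
    · refine norm_setIntegral_le_of_norm_le_const hKa.measure_lt_top ?_
      intro x _
      rw [norm_mul, mul_comm Complex.I, Complex.norm_exp_ofReal_mul_I, one_mul, norm_mul,
        RCLike.norm_conj]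
      exact mul_le_mul (hA _) (hA _) (norm_nonneg _) hA0
    · intro x hx
      have : a (x, η) = 0 := by
        by_contra hne
        exact hx ⟨(x, η), subset_tsupport _ hne, rfl⟩
      simp [this]
  have hC00 : 0 ≤ C0 := by positivity
  refine ⟨ε, hε, 2 ^ (N - 1) * (2 * (C0 + max C1 0)), fun lam η η' hηη => ?_⟩
  set I := ‖∫ ζ, Complex.exp (Complex.I * ((lam * (Φ (ζ, η) - Φ (ζ, η')) : ℝ) : ℂ)) *
          (a (ζ, η) * (starRingEnd ℂ) (a (ζ, η')))‖ with hI
  have hI0 : 0 ≤ I := norm_nonneg _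
  have hIN : (|lam| * ‖η - η'‖) ^ N * I ≤ C0 + max C1 0 := by
    by_cases hne : η = η'
    · subst hne
      simp only [sub_self, norm_zero, mul_zero]
      have : (0 : ℝ) ^ N ≤ 1 := pow_le_one₀ le_rfl zero_le_one
      calc (0 : ℝ) ^ N * I ≤ 1 * I := by gcongr
        _ ≤ C0 := by rw [one_mul]; exact hC0 lam η η
        _ ≤ _ := by linarith [le_max_right C1 0]
    · set r := ‖η - η'‖ with hr
      have hr0 : 0 < r := norm_pos_iff.2 (sub_ne_zero.2 hne)
      set ω := r⁻¹ • (η - η') with hω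
      have hη : η = η' + r • ω := by
        rw [hω, smul_smul, mul_inv_cancel₀ hr0.ne', one_smul]; abel
      have hωn : ω ∈ Metric.sphere (0 : E d) 1 := by
        simp [hω, norm_smul, ← hr, abs_of_pos hr0, hr0.ne']
      have h1 := hC1 (lam * r) (η', (r, ω))
      have h2 : (∫ ζ, Complex.exp (Complex.I * ((lam * r * F (ζ, (η', (r, ω))) : ℝ) : ℂ)) *
          b (ζ, (η', (r, ω)))) = ∫ ζ, Complex.exp (Complex.I *
            ((lam * (Φ (ζ, η) - Φ (ζ, η')) : ℝ) : ℂ)) *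
          (a (ζ, η) * (starRingEnd ℂ) (a (ζ, η'))) := by
        congr 1
        ext ζ
        rw [mul_assoc lam r, hadF_mul hΦ, ← hη]
        by_cases hz : a (ζ, η') = 0
        · simp [b, hz]
        have : χ (ζ, (η', (r, ω))) = 1 := by
          apply hχ1
          have hm : ((r, ((ζ, η'), ω)) : ℝ × ((E d × E d) × E d)) ∈ u ×ˢ v := by
            refine ⟨hεu ?_, hvK ⟨subset_tsupport _ hz, hωn⟩⟩
            simp [abs_of_pos hr0, hηη]
          exact huv hm
        simp [b, this, ← hη]
      rw [h2, ← hI, abs_mul, abs_of_pos hr0] at h1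
      linarith [le_max_left C1 0]
  have h3 : (1 + |lam| * ‖η - η'‖) ^ N ≤ 2 ^ (N - 1) * (1 ^ N + (|lam| * ‖η - η'‖) ^ N) :=
    add_pow_le zero_le_one (by positivity) N
  calc (1 + |lam| * ‖η - η'‖) ^ N * I
      ≤ (2 ^ (N - 1) * (1 ^ N + (|lam| * ‖η - η'‖) ^ N)) * I := by gcongr
    _ = 2 ^ (N - 1) * (I + (|lam| * ‖η - η'‖) ^ N * I) := by ring
    _ ≤ 2 ^ (N - 1) * (2 * (C0 + max C1 0)) := by
        gcongr
        have := hC0 lam η η'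
        linarith [le_max_right C1 0]

lemma lintegral_comp_smul_E {d : ℕ} (f : E d → ℝ≥0∞) (hf : Measurable f) {R : ℝ} (hR : R ≠ 0) :
    ∫⁻ x, f (R • x) = ENNReal.ofReal (|R| ^ d)⁻¹ * ∫⁻ x, f x := by
  have h := Measure.map_addHaar_smul (volume : Measure (E d)) hR
  have h2 : ∫⁻ x, f (R • x) = ∫⁻ x, f x ∂(Measure.map (R • ·) (volume : Measure (E d))) :=
    (lintegral_map hf (measurable_const_smul R)).symm
  rw [h2, h, lintegral_smul_measure, smul_eq_mul]
  congr 2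
  simp [abs_inv, abs_pow]

/-- The `T^*T` identity, as an inequality. -/
lemma tstar_t {d : ℕ} (T : E d × E d → ℂ) (hT : Continuous T) (hTc : HasCompactSupport T)
    (Q : Set (E d)) :
    ∫⁻ ζ, ‖∫ η in Q, T (ζ, η)‖ₑ ^ 2 ≤
      ∫⁻ p in Q ×ˢ Q, ‖∫ ζ, T (ζ, p.1) * (starRingEnd ℂ) (T (ζ, p.2))‖ₑ := by
  set ν : Measure (E d) := volume.restrict Q with hν
  let G : E d × (E d × E d) → ℂ := fun x => T (x.1, x.2.1) * (starRingEnd ℂ) (T (x.1, x.2.2))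
  have hG : Continuous G := by
    refine (hT.comp (by fun_prop)).mul (Complex.continuous_conj.comp (hT.comp (by fun_prop)))
  have hGc : HasCompactSupport G := by
    refine HasCompactSupport.intro (K := (Prod.fst '' tsupport T) ×ˢ
      ((Prod.snd '' tsupport T) ×ˢ (Prod.snd '' tsupport T))) ?_ ?_
    · exact (hTc.isCompact.image continuous_fst).prod
        ((hTc.isCompact.image continuous_snd).prod (hTc.isCompact.image continuous_snd))
    · rintro ⟨ζ, η, η'⟩ hx
      by_contra hne
      have h1 : T (ζ, η) ≠ 0 := fun h => hne (by simp [G, h])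
      have h2 : T (ζ, η') ≠ 0 := fun h => hne (by simp [G, h])
      exact hx ⟨⟨_, subset_tsupport _ h1, rfl⟩, ⟨_, subset_tsupport _ h1, rfl⟩,
        ⟨_, subset_tsupport _ h2, rfl⟩⟩
  have hGi : Integrable G ((volume : Measure (E d)).prod (ν.prod ν)) := by
    have : Integrable G (volume : Measure (E d × (E d × E d))) :=
      hG.integrable_of_hasCompactSupport hGc
    rw [hν, Measure.prod_restrict]
    have h3 := Measure.prod_restrict (μ := (volume : Measure (E d)))
      (ν := (volume : Measure (E d × E d))) Set.univ (Q ×ˢ Q)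
    rw [Measure.restrict_univ] at h3
    rw [← Measure.volume_eq_prod, h3]
    exact this.mono_measure Measure.restrict_le_self
  have hsq : ∀ ζ, ((‖∫ η in Q, T (ζ, η)‖ ^ 2 : ℝ) : ℂ) = ∫ p, G (ζ, p) ∂(ν.prod ν) := by
    intro ζ
    have := integral_prod_mul (μ := ν) (ν := ν) (fun η => T (ζ, η))
      (fun η => (starRingEnd ℂ) (T (ζ, η)))
    simp only [G]
    rw [this, integral_conj, Complex.mul_conj, Complex.normSq_eq_norm_sq]
  have hIntg : Integrable (fun ζ => ((‖∫ η in Q, T (ζ, η)‖ ^ 2 : ℝ) : ℂ)) := by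
    simp_rw [hsq]
    exact hGi.integral_prod_left
  have hswap : ∫ ζ, ((‖∫ η in Q, T (ζ, η)‖ ^ 2 : ℝ) : ℂ) =
      ∫ p, (∫ ζ, G (ζ, p)) ∂(ν.prod ν) := by
    simp_rw [hsq]
    exact integral_integral_swap (f := fun ζ p => G (ζ, p)) hGi
  have hreal : Integrable (fun ζ => ‖∫ η in Q, T (ζ, η)‖ ^ 2) := by
    have := hIntg.norm
    refine this.congr (Eventually.of_forall fun ζ => ?_)
    simp only [Complex.norm_real]
    exact Real.norm_of_nonneg (by positivity)
  calc ∫⁻ ζ, ‖∫ η in Q, T (ζ, η)‖ₑ ^ 2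
      = ∫⁻ ζ, ENNReal.ofReal (‖∫ η in Q, T (ζ, η)‖ ^ 2) := by
        congr 1
        ext ζ
        rw [ENNReal.ofReal_pow (norm_nonneg _), ofReal_norm]
    _ = ENNReal.ofReal (∫ ζ, ‖∫ η in Q, T (ζ, η)‖ ^ 2) :=
        (ofReal_integral_eq_lintegral_ofReal hreal (Eventually.of_forall fun _ => by positivity)).symm
    _ = ‖∫ p, (∫ ζ, G (ζ, p)) ∂(ν.prod ν)‖ₑ := by
        rw [← hswap, integral_complex_ofReal, ← ofReal_norm, Complex.norm_real, Real.norm_of_nonneg]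
        exact integral_nonneg fun _ => by positivity
    _ ≤ ∫⁻ p, ‖∫ ζ, G (ζ, p)‖ₑ ∂(ν.prod ν) := enorm_integral_le_lintegral_enorm _
    _ = _ := by
        rw [hν, Measure.prod_restrict]
        rfl

/-- Schur test. -/
lemma schur {d : ℕ} (G : E d → ℝ≥0∞) (hG : Measurable G)
    (h : E d → ℂ) (hh : Continuous h) :
    ∫⁻ p : E d × E d, G (p.1 - p.2) * (‖h p.1‖ₑ * ‖h p.2‖ₑ) ≤
      2 * (∫⁻ v, G v) * ∫⁻ η, ‖h η‖ₑ ^ 2 := by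
  have hm : Measurable fun η => ‖h η‖ₑ := hh.measurable.enorm
  have h1 : ∀ x y : ℝ≥0∞, x * y ≤ x ^ 2 + y ^ 2 := by
    intro x y
    rcases le_total x y with hxy | hxy
    · calc x * y ≤ y * y := by gcongr
        _ = y ^ 2 := (sq y).symm
        _ ≤ _ := le_add_self
    · calc x * y ≤ x * x := by gcongr
        _ = x ^ 2 := (sq x).symm
        _ ≤ _ := le_self_add
  have m1 : Measurable fun p : E d × E d => G (p.1 - p.2) * ‖h p.1‖ₑ ^ 2 :=
    (hG.comp (measurable_fst.sub measurable_snd)).mul ((hm.comp measurable_fst).pow_const 2)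
  have m2 : Measurable fun p : E d × E d => G (p.1 - p.2) * ‖h p.2‖ₑ ^ 2 :=
    (hG.comp (measurable_fst.sub measurable_snd)).mul ((hm.comp measurable_snd).pow_const 2)
  calc ∫⁻ p : E d × E d, G (p.1 - p.2) * (‖h p.1‖ₑ * ‖h p.2‖ₑ)
      ≤ ∫⁻ p : E d × E d, (G (p.1 - p.2) * ‖h p.1‖ₑ ^ 2 + G (p.1 - p.2) * ‖h p.2‖ₑ ^ 2) := by
        refine lintegral_mono fun p => ?_
        rw [← mul_add]
        gcongr
        exact h1 _ _
    _ = (∫⁻ p : E d × E d, G (p.1 - p.2) * ‖h p.1‖ₑ ^ 2) +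
          ∫⁻ p : E d × E d, G (p.1 - p.2) * ‖h p.2‖ₑ ^ 2 := lintegral_add_left m1 _
    _ = (∫⁻ v, G v) * (∫⁻ η, ‖h η‖ₑ ^ 2) + (∫⁻ v, G v) * (∫⁻ η, ‖h η‖ₑ ^ 2) := by
        congr 1
        · rw [Measure.volume_eq_prod, lintegral_prod _ m1.aemeasurable]
          have : ∀ x : E d, ∫⁻ y, G (x - y) * ‖h x‖ₑ ^ 2 = (∫⁻ v, G v) * ‖h x‖ₑ ^ 2 := by
            intro x
            rw [lintegral_mul_const _ (by fun_prop : Measurable fun y => G (x - y)),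
              lintegral_sub_left_eq_self]
          simp_rw [this]
          rw [lintegral_const_mul _ (hm.pow_const 2)]
        · rw [Measure.volume_eq_prod, lintegral_prod_symm _ m2.aemeasurable]
          have : ∀ y : E d, ∫⁻ x, G (x - y) * ‖h y‖ₑ ^ 2 = (∫⁻ v, G v) * ‖h y‖ₑ ^ 2 := by
            intro y
            rw [lintegral_mul_const _ (by fun_prop : Measurable fun x => G (x - y)),
              lintegral_sub_right_eq_self]
          simp_rw [this]
          rw [lintegral_const_mul _ (hm.pow_const 2)]
    _ = _ := by ring

/-- Hörmander's `L^2` bound for nondegenerate oscillatory integral operators. -/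
lemma hormander {d : ℕ} (Φ : E d × E d → ℝ) (a : E d × E d → ℂ)
    (hΦ : ContDiff ℝ (⊤ : ℕ∞) Φ) (ha : ContDiff ℝ (⊤ : ℕ∞) a) (hac : HasCompactSupport a)
    (hnd : ∀ q ∈ tsupport a, ∀ ω : E d, ω ≠ 0 →
      ∃ i, fderiv ℝ (fun q => fderiv ℝ Φ q (0, ω)) q (ev i, 0) ≠ 0) :
    ∃ C : ℝ≥0∞, C ≠ ⊤ ∧ ∀ (lam : ℝ), lam ≠ 0 → ∀ h : E d → ℂ, Continuous h →
      ∫⁻ ζ, ‖∫ η, Complex.exp (Complex.I * ((lam * Φ (ζ, η) : ℝ) : ℂ)) * a (ζ, η) * h η‖ₑ ^ 2 ≤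
        C * (ENNReal.ofReal (|lam| ^ d)⁻¹ * ∫⁻ η, ‖h η‖ₑ ^ 2) := by
  obtain ⟨ε, hε, C, hC⟩ := kernel_bound Φ a hΦ ha hac hnd (d + 1)
  let T : ℝ → (E d → ℂ) → E d × E d → ℂ := fun lam h q =>
    Complex.exp (Complex.I * ((lam * Φ q : ℝ) : ℂ)) * a q * h q.2
  have hT : ∀ lam h, Continuous h → Continuous (T lam h) := by
    intro lam h hh
    have h1 := hΦ.continuous
    have h2 := ha.continuous
    simp only [T]
    fun_prop
  have hTs : ∀ lam h, Function.support (T lam h) ⊆ Function.support a := by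
    intro lam h q hq h0
    exact hq (by simp [T, h0])
  have hTc : ∀ lam h, HasCompactSupport (T lam h) := fun lam h =>
    hac.of_isClosed_subset (isClosed_tsupport _) (closure_mono (hTs lam h))
  let g : E d → ℝ≥0∞ := fun v => ENNReal.ofReal ((1 + ‖v‖) ^ (-((d + 1 : ℕ) : ℝ)))
  have hgm : Measurable g := by
    simp only [g]
    fun_prop
  let J : ℝ≥0∞ := ∫⁻ v, g v
  have hJ : J ≠ ⊤ := by
    have := (integrable_one_add_norm (E := E d) (μ := volume) (r := ((d + 1 : ℕ) : ℝ))
      (by simp)).lintegral_lt_top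
    exact this.ne
  -- the local bound
  have hloc : ∀ Q : Set (E d), MeasurableSet Q → (∀ η ∈ Q, ∀ η' ∈ Q, ‖η - η'‖ < ε) →
      ∀ lam : ℝ, lam ≠ 0 → ∀ h : E d → ℂ, Continuous h →
      ∫⁻ ζ, ‖∫ η in Q, T lam h (ζ, η)‖ₑ ^ 2 ≤
        (ENNReal.ofReal C * (2 * J)) * (ENNReal.ofReal (|lam| ^ d)⁻¹ * ∫⁻ η, ‖h η‖ₑ ^ 2) := by
    intro Q hQ hQε lam hlam h hh
    refine (tstar_t (T lam h) (hT lam h hh) (hTc lam h) Q).trans ?_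
    have hk : ∀ p ∈ Q ×ˢ Q, ‖∫ ζ, T lam h (ζ, p.1) * (starRingEnd ℂ) (T lam h (ζ, p.2))‖ₑ ≤
        ENNReal.ofReal C * (g (lam • (p.1 - p.2)) * (‖h p.1‖ₑ * ‖h p.2‖ₑ)) := by
      rintro ⟨η, η'⟩ ⟨hη, hη'⟩
      have h1 : ∀ ζ, T lam h (ζ, η) * (starRingEnd ℂ) (T lam h (ζ, η')) =
          (Complex.exp (Complex.I * ((lam * (Φ (ζ, η) - Φ (ζ, η')) : ℝ) : ℂ)) *
          (a (ζ, η) * (starRingEnd ℂ) (a (ζ, η')))) * (h η * (starRingEnd ℂ) (h η')) := by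
        intro ζ
        have : Complex.exp (Complex.I * ((lam * (Φ (ζ, η) - Φ (ζ, η')) : ℝ) : ℂ)) =
            Complex.exp (Complex.I * ((lam * Φ (ζ, η) : ℝ) : ℂ)) *
            (starRingEnd ℂ) (Complex.exp (Complex.I * ((lam * Φ (ζ, η') : ℝ) : ℂ))) := by
          rw [← Complex.exp_conj, ← Complex.exp_add]
          congr 1
          simp only [map_mul, Complex.conj_I, Complex.conj_ofReal]
          push_cast
          ring
        rw [this]
        simp only [T, map_mul]
        ring
      simp_rw [h1]
      rw [integral_mul_const, enorm_mul, enorm_mul, ← mul_assoc (ENNReal.ofReal C)]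
      have hconj : ‖(starRingEnd ℂ) (h η')‖ₑ = ‖h η'‖ₑ := by
        rw [← ofReal_norm, RCLike.norm_conj, ofReal_norm]
      rw [hconj]
      gcongr
      have h2 := hC lam η η' (hQε η hη η' hη')
      have hpos : 0 < (1 + |lam| * ‖η - η'‖) ^ (d + 1) := by positivity
      rw [← ofReal_norm]
      change _ ≤ ENNReal.ofReal C * ENNReal.ofReal _
      rw [← ENNReal.ofReal_mul' (by positivity)]
      apply ENNReal.ofReal_le_ofReal
      rw [Real.rpow_neg (by positivity), Real.rpow_natCast, norm_smul, Real.norm_eq_abs,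
        ← div_eq_mul_inv, le_div_iff₀ hpos, mul_comm]
      exact h2
    calc ∫⁻ p in Q ×ˢ Q, ‖∫ ζ, T lam h (ζ, p.1) * (starRingEnd ℂ) (T lam h (ζ, p.2))‖ₑ
        ≤ ∫⁻ p in Q ×ˢ Q,
            ENNReal.ofReal C * (g (lam • (p.1 - p.2)) * (‖h p.1‖ₑ * ‖h p.2‖ₑ)) :=
          setLIntegral_mono' (hQ.prod hQ) hk
      _ ≤ ∫⁻ p : E d × E d,
            ENNReal.ofReal C * (g (lam • (p.1 - p.2)) * (‖h p.1‖ₑ * ‖h p.2‖ₑ)) :=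
          setLIntegral_le_lintegral _ _
      _ = ENNReal.ofReal C * ∫⁻ p : E d × E d,
            (g (lam • (p.1 - p.2)) * (‖h p.1‖ₑ * ‖h p.2‖ₑ)) :=
          lintegral_const_mul' _ _ ENNReal.ofReal_ne_top
      _ ≤ ENNReal.ofReal C * (2 * (∫⁻ v, g (lam • v)) * ∫⁻ η, ‖h η‖ₑ ^ 2) := by
          gcongr
          refine schur (fun v => g (lam • v)) (hgm.comp (measurable_const_smul lam)) h hh
      _ = _ := by
          rw [lintegral_comp_smul_E g hgm hlam]
          ring
  -- globalization
  have hglob : ∃ s', MeasurableSet s' ∧ (Prod.snd '' tsupport a) ⊆ s' ∧ ∃ C : ℝ≥0∞, C ≠ ⊤ ∧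
      ∀ Q ⊆ s', MeasurableSet Q → ∀ lam : ℝ, lam ≠ 0 → ∀ h : E d → ℂ, Continuous h →
      ∫⁻ ζ, ‖∫ η in Q, T lam h (ζ, η)‖ₑ ^ 2 ≤
        C * (ENNReal.ofReal (|lam| ^ d)⁻¹ * ∫⁻ η, ‖h η‖ₑ ^ 2) := by
    refine IsCompact.induction_on (hac.isCompact.image continuous_snd) (p := fun s =>
      ∃ s', MeasurableSet s' ∧ s ⊆ s' ∧ ∃ C : ℝ≥0∞, C ≠ ⊤ ∧
      ∀ Q ⊆ s', MeasurableSet Q → ∀ lam : ℝ, lam ≠ 0 → ∀ h : E d → ℂ, Continuous h →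
      ∫⁻ ζ, ‖∫ η in Q, T lam h (ζ, η)‖ₑ ^ 2 ≤
        C * (ENNReal.ofReal (|lam| ^ d)⁻¹ * ∫⁻ η, ‖h η‖ₑ ^ 2)) ?_ ?_ ?_ ?_
    · refine ⟨∅, MeasurableSet.empty, subset_rfl, 0, by simp, ?_⟩
      intro Q hQ _ lam _ h _
      rw [Set.subset_empty_iff.1 hQ]
      simp
    · rintro s t hst ⟨s', hs', hts', hrest⟩
      exact ⟨s', hs', hst.trans hts', hrest⟩
    · rintro s t ⟨s', hs', hss', C1, hC1, hb1⟩ ⟨t', ht', htt', C2, hC2, hb2⟩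
      refine ⟨s' ∪ t', hs'.union ht', Set.union_subset_union hss' htt', 2 * (C1 + C2),
        ENNReal.mul_ne_top (by simp) (ENNReal.add_ne_top.2 ⟨hC1, hC2⟩), ?_⟩
      intro Q hQ hQm lam hlam h hh
      have hi : ∀ ζ, Integrable (fun η => T lam h (ζ, η)) := by
        intro ζ
        refine Continuous.integrable_of_hasCompactSupport
          ((hT lam h hh).comp (by fun_prop : Continuous fun η : E d => (ζ, η))) ?_
        refine HasCompactSupport.intro ((hTc lam h).isCompact.image continuous_snd) fun x hx => ?_
        by_contra hne
        exact hx ⟨(ζ, x), subset_tsupport _ hne, rfl⟩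
      have hsplit : ∀ ζ, ∫ η in Q, T lam h (ζ, η) =
          (∫ η in Q ∩ s', T lam h (ζ, η)) + ∫ η in Q \ s', T lam h (ζ, η) := fun ζ =>
        (integral_inter_add_sdiff hs' (hi ζ).integrableOn).symm
      have hb1' := hb1 (Q ∩ s') Set.inter_subset_right (hQm.inter hs') lam hlam h hh
      have hb2' := hb2 (Q \ s') (fun x hx => (hQ hx.1).resolve_left hx.2) (hQm.diff hs') lam hlam h hh
      have hsq : ∀ x y : ℂ, ‖x + y‖ₑ ^ 2 ≤ 2 * (‖x‖ₑ ^ 2 + ‖y‖ₑ ^ 2) := by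
        intro x y
        have h1 : ‖x + y‖ ^ 2 ≤ 2 * (‖x‖ ^ 2 + ‖y‖ ^ 2) := by
          have := norm_add_le x y
          nlinarith [norm_nonneg (x + y), sq_nonneg (‖x‖ - ‖y‖), norm_nonneg x, norm_nonneg y]
        have h2 := ENNReal.ofReal_le_ofReal h1
        rw [ENNReal.ofReal_mul (by norm_num), ENNReal.ofReal_add (by positivity) (by positivity),
          ENNReal.ofReal_pow (norm_nonneg _), ENNReal.ofReal_pow (norm_nonneg _),
          ENNReal.ofReal_pow (norm_nonneg _)] at h2
        simpa only [ofReal_norm, ENNReal.ofReal_ofNat] using h2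
      have hmeas : Measurable fun ζ => ‖∫ η in Q ∩ s', T lam h (ζ, η)‖ₑ ^ 2 := by
        have : StronglyMeasurable fun ζ => ∫ η in Q ∩ s', T lam h (ζ, η) :=
          (hT lam h hh).stronglyMeasurable.integral_prod_right'
        exact this.measurable.enorm.pow_const 2
      calc ∫⁻ ζ, ‖∫ η in Q, T lam h (ζ, η)‖ₑ ^ 2
          ≤ ∫⁻ ζ, 2 * (‖∫ η in Q ∩ s', T lam h (ζ, η)‖ₑ ^ 2 +
              ‖∫ η in Q \ s', T lam h (ζ, η)‖ₑ ^ 2) := by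
            refine lintegral_mono fun ζ => ?_
            rw [hsplit]
            exact hsq _ _
        _ = 2 * ((∫⁻ ζ, ‖∫ η in Q ∩ s', T lam h (ζ, η)‖ₑ ^ 2) +
              ∫⁻ ζ, ‖∫ η in Q \ s', T lam h (ζ, η)‖ₑ ^ 2) := by
            rw [lintegral_const_mul' _ _ (by simp), lintegral_add_left hmeas]
        _ ≤ 2 * (C1 * (ENNReal.ofReal (|lam| ^ d)⁻¹ * ∫⁻ η, ‖h η‖ₑ ^ 2) +
              C2 * (ENNReal.ofReal (|lam| ^ d)⁻¹ * ∫⁻ η, ‖h η‖ₑ ^ 2)) := by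
            gcongr
        _ = _ := by ring
    · intro x _
      refine ⟨Metric.ball x (ε / 2), mem_nhdsWithin_of_mem_nhds (Metric.ball_mem_nhds x (by positivity)),
        Metric.ball x (ε / 2), Metric.isOpen_ball.measurableSet, subset_rfl,
        ENNReal.ofReal C * (2 * J), ENNReal.mul_ne_top ENNReal.ofReal_ne_top
          (ENNReal.mul_ne_top (by simp) hJ), ?_⟩
      intro Q hQ hQm lam hlam h hh
      refine hloc Q hQm ?_ lam hlam h hh
      intro η hη η' hη'
      have h1 := Metric.mem_ball.1 (hQ hη)
      have h2 := Metric.mem_ball.1 (hQ hη')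
      rw [← dist_eq_norm]
      have := dist_triangle_right η η' x
      linarith
  obtain ⟨s', hs', hsub, C', hC', hb⟩ := hglob
  refine ⟨C', hC', fun lam hlam h hh => ?_⟩
  have := hb s' subset_rfl hs' lam hlam h hh
  convert this using 4 with ζ
  congr 1
  symm
  refine setIntegral_eq_integral_of_forall_compl_eq_zero fun η hη => ?_
  by_contra hne
  exact hη (hsub ⟨(ζ, η), subset_tsupport _ (hTs lam h hne), rfl⟩)

section FTSection

open scoped FourierTransform

lemma FT_eq {d : ℕ} (u : 𝓢(E d, ℂ)) (ξ : E d) :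
    FT (⇑u) ξ = (((2 * Real.pi) ^ (-(d : ℝ) / 2) : ℝ) : ℂ) * (𝓕 u) ((2 * Real.pi)⁻¹ • ξ) := by
  unfold FT
  congr 1
  rw [SchwartzMap.fourier_coe, Real.fourier_eq']
  congr 1
  ext x
  rw [smul_eq_mul]
  congr 2
  rw [inner_smul_right]
  have : (Real.pi : ℂ) ≠ 0 := by exact_mod_cast Real.pi_ne_zero
  push_cast
  field_simp

lemma FT_contDiff {d : ℕ} (u : 𝓢(E d, ℂ)) : ContDiff ℝ (⊤ : ℕ∞) (FT (⇑u)) := by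
  have : FT (⇑u) = fun ξ => (((2 * Real.pi) ^ (-(d : ℝ) / 2) : ℝ) : ℂ) *
      (𝓕 u) ((2 * Real.pi)⁻¹ • ξ) := funext (FT_eq u)
  rw [this]
  exact contDiff_const.mul (((𝓕 u).smooth _).comp (by fun_prop))

lemma lintegral_enorm_sq_schwartz {d : ℕ} (u : 𝓢(E d, ℂ)) :
    ∫⁻ x, ‖u x‖ₑ ^ 2 = ENNReal.ofReal (∫ x, ‖u x‖ ^ 2) := by
  rw [ofReal_integral_eq_lintegral_ofReal]
  · congr 1
    ext x
    rw [ENNReal.ofReal_pow (norm_nonneg _), ofReal_norm]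
  · exact (u.memLp 2 volume).integrable_norm_pow (by norm_num)
  · exact Eventually.of_forall fun _ => by positivity

lemma FT_plancherel {d : ℕ} (u : 𝓢(E d, ℂ)) :
    ∫⁻ ξ, ‖FT (⇑u) ξ‖ₑ ^ 2 = ∫⁻ x, ‖u x‖ₑ ^ 2 := by
  have h2 : (0 : ℝ) < 2 * Real.pi := by positivity
  have hm : Measurable fun ξ : E d => ‖(𝓕 u : 𝓢(E d, ℂ)) ξ‖ₑ ^ 2 :=
    ((𝓕 u : 𝓢(E d, ℂ)).continuous.measurable.enorm).pow_const 2
  have hsc := lintegral_comp_smul_E (d := d) (fun ξ : E d => ‖(𝓕 u : 𝓢(E d, ℂ)) ξ‖ₑ ^ 2) hm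
    (inv_ne_zero h2.ne')
  simp_rw [FT_eq, enorm_mul, mul_pow]
  rw [lintegral_const_mul' _ _ (by simp),
    hsc, lintegral_enorm_sq_schwartz (𝓕 u), SchwartzMap.integral_norm_sq_fourier,
    ← lintegral_enorm_sq_schwartz, ← mul_assoc]
  have h3 : ‖(((2 * Real.pi) ^ (-(d : ℝ) / 2) : ℝ) : ℂ)‖ₑ ^ 2 *
      ENNReal.ofReal (|(2 * Real.pi)⁻¹| ^ d)⁻¹ = 1 := by
    rw [← ofReal_norm, Complex.norm_real, Real.norm_of_nonneg (by positivity),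
      ← ENNReal.ofReal_pow (by positivity), ← ENNReal.ofReal_mul (by positivity),
      ← Real.rpow_natCast, ← Real.rpow_mul h2.le, abs_inv, abs_of_pos h2, inv_pow, inv_inv,
      ← Real.rpow_natCast (2 * Real.pi) d, ← Real.rpow_add h2]
    have : -(d : ℝ) / 2 * (2 : ℕ) + d = 0 := by push_cast; ring
    rw [this]
    simp
  rw [h3, one_mul]

/-- the change of variables `(ζ,η) ↦ (η, ζ-η)` -/
def Lsub (d : ℕ) : (E d × E d) ≃L[ℝ] (E d × E d) :=
  ContinuousLinearEquiv.equivOfInverse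
    ((ContinuousLinearMap.snd ℝ (E d) (E d)).prod
      (ContinuousLinearMap.fst ℝ (E d) (E d) - ContinuousLinearMap.snd ℝ (E d) (E d)))
    ((ContinuousLinearMap.fst ℝ (E d) (E d) + ContinuousLinearMap.snd ℝ (E d) (E d)).prod
      (ContinuousLinearMap.fst ℝ (E d) (E d)))
    (by intro x; simp) (by intro x; simp)

lemma Lsub_apply {d : ℕ} (q : E d × E d) : Lsub d q = (q.2, q.1 - q.2) := rfl

/-- Change of variables in the double integral. -/
lemma integral_Lsub {d : ℕ} (H : E d × E d → ℂ) (hH : Continuous H) (hHc : HasCompactSupport H) :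
    ∫ p, H p = ∫ ζ, ∫ η, H (η, ζ - η) := by
  have hi : Integrable H := hH.integrable_of_hasCompactSupport hHc
  have hi2 : Integrable (fun q : E d × E d => H (q.1, q.2 - q.1)) := by
    refine Continuous.integrable_of_hasCompactSupport (by fun_prop) ?_
    exact hHc.comp_homeomorph
      ((Homeomorph.prodComm (E d) (E d)).trans (Lsub d).toHomeomorph)
  rw [Measure.volume_eq_prod, integral_prod _ hi]
  have : ∀ η : E d, ∫ ξ, H (η, ξ) = ∫ ζ, H (η, ζ - η) := fun η =>
    (integral_sub_right_eq_self (fun ξ => H (η, ξ)) η).symm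
  simp_rw [this]
  exact integral_integral_swap (f := fun η ζ => H (η, ζ - η)) hi2

/-- A crude weighted Cauchy-Schwarz inequality. -/
lemma crude_cs {d : ℕ} (G s : E d → ℝ≥0∞) (hG : Measurable G) (hs : Measurable s) :
    (∫⁻ y, G y * s y) ^ 2 ≤ 2 * (∫⁻ y, G y) * ∫⁻ y, G y * s y ^ 2 := by
  have h1 : ∀ x y : ℝ≥0∞, x * y ≤ x ^ 2 + y ^ 2 := by
    intro x y
    rcases le_total x y with hxy | hxy
    · calc x * y ≤ y * y := by gcongr
        _ = y ^ 2 := (sq y).symm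
        _ ≤ _ := le_add_self
    · calc x * y ≤ x * x := by gcongr
        _ = x ^ 2 := (sq x).symm
        _ ≤ _ := le_self_add
  have hm1 : Measurable fun y => G y * s y := by fun_prop
  have hm2 : Measurable fun y => G y * s y ^ 2 := by fun_prop
  have hm3 : Measurable fun y => G y * s y ^ 2 * ∫⁻ y', G y' := hm2.mul_const _
  calc (∫⁻ y, G y * s y) ^ 2 = ∫⁻ y, ∫⁻ y', (G y * s y) * (G y' * s y') := by
        rw [sq, ← lintegral_mul_const _ hm1]
        congr 1
        ext y
        rw [lintegral_const_mul _ hm1]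
    _ ≤ ∫⁻ y, ∫⁻ y', (G y * s y ^ 2) * G y' + G y * (G y' * s y' ^ 2) := by
        refine lintegral_mono fun y => lintegral_mono fun y' => ?_
        calc (G y * s y) * (G y' * s y') = (G y * G y') * (s y * s y') := by ring
          _ ≤ (G y * G y') * (s y ^ 2 + s y' ^ 2) := by gcongr; exact h1 _ _
          _ = _ := by ring
    _ = ∫⁻ y, ((G y * s y ^ 2) * (∫⁻ y', G y') + G y * ∫⁻ y', G y' * s y' ^ 2) := by
        congr 1
        ext y
        rw [lintegral_add_left (hG.const_mul _), lintegral_const_mul _ hG,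
          lintegral_const_mul _ hm2]
    _ = _ := by
        rw [lintegral_add_left hm3,
          lintegral_mul_const _ hm2, lintegral_mul_const _ hG]
        ring

/-- translation of the nondegeneracy condition -/
lemma nondeg_transfer {d : ℕ} (φ : E d × E d → ℝ) (hφ : ContDiff ℝ (⊤ : ℕ∞) φ)
    (q : E d × E d)
    (hdet : (derMat φ (Lsub d q) xiV (fun j => etaV j - xiV j)).det ≠ 0)
    (ω : E d) (hω : ω ≠ 0) :
    ∃ i, fderiv ℝ (fun q => fderiv ℝ (fun q => φ (Lsub d q)) q (0, ω)) q (ev i, 0) ≠ 0 := by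
  have hdφ : Differentiable ℝ φ := hφ.differentiable (by simp)
  have hd2 : Differentiable ℝ (fderiv ℝ φ) :=
    (hφ.fderiv_right (m := (⊤ : ℕ∞)) (by simp)).differentiable (by simp)
  have h1 : ∀ q, fderiv ℝ (fun q => φ (Lsub d q)) q (0, ω) = fderiv ℝ φ (Lsub d q) (ω, -ω) := by
    intro q
    have h := (hdφ (Lsub d q)).hasFDerivAt.comp q (Lsub d).hasFDerivAt
    have h' : HasFDerivAt (fun q => φ (Lsub d q)) _ q := h
    rw [h'.fderiv]
    simp [Lsub_apply]
  have hD : ∀ p u v, D2 φ p u v = fderiv ℝ (fderiv ℝ φ) p v u := by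
    intro p u v
    unfold D2
    have h := (hd2 p).hasFDerivAt.clm_apply (hasFDerivAt_const u p)
    rw [h.fderiv]
    simp
  have h2 : ∀ i, fderiv ℝ (fun q => fderiv ℝ (fun q => φ (Lsub d q)) q (0, ω)) q (ev i, 0) =
      D2 φ (Lsub d q) (ω, -ω) (xiV i) := by
    intro i
    simp_rw [h1]
    have h0 : DifferentiableAt ℝ (fun p => fderiv ℝ φ p (ω, -ω)) (Lsub d q) :=
      (hd2 _).clm_apply (differentiableAt_const _)
    have h := h0.hasFDerivAt.comp q (Lsub d).hasFDerivAt
    have h' : HasFDerivAt (fun q => fderiv ℝ φ (Lsub d q) (ω, -ω)) _ q := h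
    rw [h'.fderiv]
    simp [Lsub_apply, D2, xiV]
  have hω1 : (ω, -ω) = ∑ j, ω j • ((etaV j : E d × E d) - xiV j) := by
    have hs : ω = ∑ j, ω j • (ev j : E d) := by
      ext k
      simp [ev, Pi.single_apply]
    refine Prod.ext ?_ ?_
    · simp only [Prod.fst_sum, Prod.smul_fst, Prod.fst_sub, etaV, xiV, sub_zero]
      exact hs
    · simp only [Prod.snd_sum, Prod.smul_snd, Prod.snd_sub, etaV, xiV, zero_sub, smul_neg,
        Finset.sum_neg_distrib]
      rw [← hs]
  by_contra hcon
  push Not at hcon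
  have hmv : (derMat φ (Lsub d q) xiV (fun j => etaV j - xiV j)).mulVec (fun j => ω j) = 0 := by
    ext i
    have h3 := hcon i
    rw [h2, hD, hω1, map_sum] at h3
    simp only [Matrix.mulVec, dotProduct, derMat, Matrix.of_apply, hD, Pi.zero_apply]
    rw [← h3]
    refine Finset.sum_congr rfl fun j _ => ?_
    rw [map_smul, smul_eq_mul, mul_comm]
  have h0 := Matrix.eq_zero_of_mulVec_eq_zero hdet hmv
  apply hω
  ext j
  exact congrFun h0 j

end FTSection

/-- Partial integrals of smooth compactly supported functions are Schwartz. -/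
lemma partial_schwartz {d : ℕ} (K : E d × E d → ℂ) (hK : ContDiff ℝ (⊤ : ℕ∞) K)
    (hKc : HasCompactSupport K) : ∃ u : 𝓢(E d, ℂ), ∀ ζ, u ζ = ∫ η, K (ζ, η) := by
  have hS : IsCompact (Prod.snd '' tsupport K) := IsCompact.image hKc continuous_snd
  have h1 : (fun ζ => ∫ η, K (ζ, η)) = fun ζ => ∫ η in Prod.snd '' tsupport K, K (ζ, η) := by
    ext ζ
    refine (setIntegral_eq_integral_of_forall_compl_eq_zero fun η hη => ?_).symm
    by_contra h
    exact hη ⟨(ζ, η), subset_tsupport _ h, rfl⟩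
  have h2 : ContDiff ℝ (⊤ : ℕ∞) (fun ζ => ∫ η, K (ζ, η)) := by
    rw [h1]
    exact contDiff_setIntegral volume hS K hK
  have h3 : HasCompactSupport (fun ζ => ∫ η, K (ζ, η)) := by
    refine HasCompactSupport.intro (IsCompact.image hKc continuous_fst) fun ζ hζ => ?_
    have : ∀ η, K (ζ, η) = 0 := by
      intro η
      by_contra h
      exact hζ ⟨(ζ, η), subset_tsupport _ h, rfl⟩
    simp [this]
  exact ⟨h3.toSchwartzMap h2, fun ζ => rfl⟩

/-- `B_λ(f,g)` is an inverse Fourier transform. -/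
lemma Bop_eq {d : ℕ} (φ : E d × E d → ℝ) (m : E d × E d → ℂ)
    (hφs : ContDiff ℝ (⊤ : ℕ∞) φ)
    (hms : ContDiff ℝ (⊤ : ℕ∞) m) (hmc : HasCompactSupport m) (lam : ℝ) (f g : 𝓢(E d, ℂ))
    (u : 𝓢(E d, ℂ)) (hu : ∀ ζ, u ζ = ∫ η, Complex.exp (Complex.I * ((lam * φ (Lsub d (ζ, η)) : ℝ) : ℂ))
      * m (Lsub d (ζ, η)) * (FT (⇑f) η * FT (⇑g) (ζ - η))) (x : E d) :
    Bop m φ lam f g x = FT (⇑u) (-x) := by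
  unfold Bop FT
  congr 1
  have hcf := (FT_contDiff f).continuous
  have hcg := (FT_contDiff g).continuous
  have hcφ := hφs.continuous
  have hcm := hms.continuous
  have h := integral_Lsub (fun p : E d × E d =>
    Complex.exp (Complex.I * ((⟪x, p.1 + p.2⟫ + lam * φ p : ℝ) : ℂ)) *
        m p * FT (⇑f) p.1 * FT (⇑g) p.2) (by fun_prop)
        (by
          refine hmc.mono ?_
          intro p hp hmp
          apply hp
          simp [hmp])
  unfold FT at h hu
  rw [h]
  congr 1
  ext ζ
  rw [hu, ← integral_const_mul]
  congr 1
  ext η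
  simp only [Lsub_apply]
  have hexp : Complex.exp (Complex.I * ((⟪x, η + (ζ - η)⟫ + lam * φ (η, ζ - η) : ℝ) : ℂ)) =
      Complex.exp (-(Complex.I * ((⟪ζ, -x⟫ : ℝ) : ℂ))) *
        Complex.exp (Complex.I * ((lam * φ (η, ζ - η) : ℝ) : ℂ)) := by
    rw [← Complex.exp_add, inner_neg_right, real_inner_comm, add_sub_cancel]
    congr 1
    push_cast
    ring
  rw [hexp]
  ring

/-- Domination by frozen-frequency operators. -/
lemma W_bound {d : ℕ} (T : E d × E d → ℂ) (hT : Continuous T) (hTc : HasCompactSupport T)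
    (F : E d → ℂ) (hF : Continuous F) (g : 𝓢(E d, ℂ)) (ζ : E d) :
    ‖∫ η, T (ζ, η) * (F η * FT (⇑g) (ζ - η))‖ₑ ≤
      ‖(((2 * Real.pi) ^ (-(d : ℝ) / 2) : ℝ) : ℂ)‖ₑ *
       ∫⁻ y, ‖g y‖ₑ * ‖∫ η, T (ζ, η) * (Complex.exp (Complex.I * ((⟪y, η⟫ : ℝ) : ℂ)) * F η)‖ₑ := by
  set c : ℂ := (((2 * Real.pi) ^ (-(d : ℝ) / 2) : ℝ) : ℂ) with hc
  have hgc := g.continuous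
  have hi : Integrable (fun q : E d × E d => (T (ζ, q.1) * F q.1) *
      (Complex.exp (-(Complex.I * ((⟪q.2, ζ - q.1⟫ : ℝ) : ℂ))) * g q.2)) := by
    have h1 : Integrable (fun η => T (ζ, η) * F η) := by
      refine Continuous.integrable_of_hasCompactSupport (by fun_prop) ?_
      have h2 : HasCompactSupport (fun η => T (ζ, η)) := by
        refine HasCompactSupport.intro (IsCompact.image hTc continuous_snd) fun η hη => ?_
        by_contra h
        exact hη ⟨(ζ, η), subset_tsupport _ h, rfl⟩
      exact h2.mul_right
    have h3 : Integrable (fun q : E d × E d => (T (ζ, q.1) * F q.1) * g q.2) :=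
      h1.mul_prod (g.integrable)
    refine h3.mono (Continuous.aestronglyMeasurable (by fun_prop)) (Eventually.of_forall fun q => ?_)
    have : ‖Complex.exp (-(Complex.I * ((⟪q.2, ζ - q.1⟫ : ℝ) : ℂ)))‖ = 1 := by
      rw [← mul_neg, ← Complex.ofReal_neg, mul_comm, Complex.norm_exp_ofReal_mul_I]
    simp only [norm_mul, this, one_mul, le_refl]
  have h1 : ∫ η, T (ζ, η) * (F η * FT (⇑g) (ζ - η)) =
      c * ∫ y, (Complex.exp (-(Complex.I * ((⟪y, ζ⟫ : ℝ) : ℂ))) * g y) *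
        ∫ η, T (ζ, η) * (Complex.exp (Complex.I * ((⟪y, η⟫ : ℝ) : ℂ)) * F η) := by
    have h2 : ∀ η, T (ζ, η) * (F η * FT (⇑g) (ζ - η)) = c * ∫ y, (T (ζ, η) * F η) *
      (Complex.exp (-(Complex.I * ((⟪y, ζ - η⟫ : ℝ) : ℂ))) * g y) := by
      intro η
      rw [integral_const_mul]
      unfold FT
      rw [← hc]
      ring
    simp_rw [h2]
    rw [integral_const_mul]
    congr 1
    rw [integral_integral_swap (f := fun η y => (T (ζ, η) * F η) *
      (Complex.exp (-(Complex.I * ((⟪y, ζ - η⟫ : ℝ) : ℂ))) * g y)) hi]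
    congr 1
    ext y
    rw [← integral_const_mul]
    congr 1
    ext η
    have : Complex.exp (-(Complex.I * ((⟪y, ζ - η⟫ : ℝ) : ℂ))) =
       Complex.exp (-(Complex.I * ((⟪y, ζ⟫ : ℝ) : ℂ))) *
       Complex.exp (Complex.I * ((⟪y, η⟫ : ℝ) : ℂ)) := by
      rw [← Complex.exp_add, inner_sub_right]
      congr 1
      push_cast
      ring
    rw [this]
    ring
  rw [h1, enorm_mul]
  gcongr
  refine (enorm_integral_le_lintegral_enorm _).trans (lintegral_mono fun y => ?_)
  rw [enorm_mul, enorm_mul]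
  have : ‖Complex.exp (-(Complex.I * ((⟪y, ζ⟫ : ℝ) : ℂ)))‖ₑ = 1 := by
    rw [← ofReal_norm, ← mul_neg, ← Complex.ofReal_neg, mul_comm, Complex.norm_exp_ofReal_mul_I]
    simp
  rw [this, one_mul]

lemma final_L2 {d : ℕ} (T : E d × E d → ℂ) (hT : Continuous T) (hTc : HasCompactSupport T)
    (B : ℝ≥0∞)
    (hB : ∀ h : E d → ℂ, Continuous h → ∫⁻ ζ, ‖∫ η, T (ζ, η) * h η‖ₑ ^ 2 ≤ B * ∫⁻ η, ‖h η‖ₑ ^ 2)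
    (F : E d → ℂ) (hF : Continuous F) (g : 𝓢(E d, ℂ)) :
    ∫⁻ ζ, ‖∫ η, T (ζ, η) * (F η * FT (⇑g) (ζ - η))‖ₑ ^ 2 ≤
      (‖(((2 * Real.pi) ^ (-(d : ℝ) / 2) : ℝ) : ℂ)‖ₑ ^ 2 * 2) * B *
       ((∫⁻ η, ‖F η‖ₑ ^ 2) * (∫⁻ y, ‖g y‖ₑ) ^ 2) := by
  set c : ℂ := (((2 * Real.pi) ^ (-(d : ℝ) / 2) : ℝ) : ℂ) with hc
  have hgm : Measurable fun y => ‖g y‖ₑ := g.continuous.measurable.enorm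
  set S : E d × E d → ℂ := fun p =>
    ∫ η, T (p.1, η) * (Complex.exp (Complex.I * ((⟪p.2, η⟫ : ℝ) : ℂ)) * F η) with hSdef
  have hSm : Measurable S := by
    have hcont : Continuous (fun r : (E d × E d) × E d =>
      T (r.1.1, r.2) * (Complex.exp (Complex.I * ((⟪r.1.2, r.2⟫ : ℝ) : ℂ)) * F r.2)) := by
      fun_prop
    exact (hcont.stronglyMeasurable.integral_prod_right' (ν := (volume : Measure (E d)))).measurable
  have hS2 : Measurable (fun p : E d × E d => ‖g p.2‖ₑ * ‖S p‖ₑ ^ 2) :=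
    (hgm.comp measurable_snd).mul (hSm.enorm.pow_const 2)
  have hsec : ∀ ζ, Measurable fun y => ‖S (ζ, y)‖ₑ := fun ζ =>
    (hSm.comp measurable_prodMk_left).enorm
  have hy : ∀ y, ∫⁻ ζ, ‖S (ζ, y)‖ₑ ^ 2 ≤ B * ∫⁻ η, ‖F η‖ₑ ^ 2 := by
    intro y
    have h := hB (fun η => Complex.exp (Complex.I * ((⟪y, η⟫ : ℝ) : ℂ)) * F η) (by fun_prop)
    refine h.trans (le_of_eq ?_)
    congr 2
    ext η
    rw [enorm_mul]
    have : ‖Complex.exp (Complex.I * ((⟪y, η⟫ : ℝ) : ℂ))‖ₑ = 1 := by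
      rw [← ofReal_norm, mul_comm, Complex.norm_exp_ofReal_mul_I]
      simp
    rw [this, one_mul]
  calc ∫⁻ ζ, ‖∫ η, T (ζ, η) * (F η * FT (⇑g) (ζ - η))‖ₑ ^ 2
      ≤ ∫⁻ ζ, (‖c‖ₑ ^ 2 * 2 * ∫⁻ y, ‖g y‖ₑ) * ∫⁻ y, ‖g y‖ₑ * ‖S (ζ, y)‖ₑ ^ 2 := by
        refine lintegral_mono fun ζ => ?_
        calc _ ≤ (‖c‖ₑ * ∫⁻ y, ‖g y‖ₑ * ‖S (ζ, y)‖ₑ) ^ 2 := by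
              gcongr
              exact W_bound T hT hTc F hF g ζ
          _ = ‖c‖ₑ ^ 2 * (∫⁻ y, ‖g y‖ₑ * ‖S (ζ, y)‖ₑ) ^ 2 := mul_pow _ _ _
          _ ≤ ‖c‖ₑ ^ 2 * (2 * (∫⁻ y, ‖g y‖ₑ) * ∫⁻ y, ‖g y‖ₑ * ‖S (ζ, y)‖ₑ ^ 2) := by
              gcongr
              exact crude_cs _ _ hgm (hsec ζ)
          _ = _ := by ring
    _ = (‖c‖ₑ ^ 2 * 2 * ∫⁻ y, ‖g y‖ₑ) * ∫⁻ ζ, ∫⁻ y, ‖g y‖ₑ * ‖S (ζ, y)‖ₑ ^ 2 :=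
        lintegral_const_mul _ hS2.lintegral_prod_right'
    _ = (‖c‖ₑ ^ 2 * 2 * ∫⁻ y, ‖g y‖ₑ) * ∫⁻ y, ∫⁻ ζ, ‖g y‖ₑ * ‖S (ζ, y)‖ₑ ^ 2 := by
        rw [lintegral_lintegral_swap (f := fun ζ y => ‖g y‖ₑ * ‖S (ζ, y)‖ₑ ^ 2) hS2.aemeasurable]
    _ ≤ (‖c‖ₑ ^ 2 * 2 * ∫⁻ y, ‖g y‖ₑ) * ∫⁻ y, ‖g y‖ₑ * (B * ∫⁻ η, ‖F η‖ₑ ^ 2) := by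
        gcongr with y
        rw [lintegral_const_mul' _ _ enorm_ne_top]
        gcongr
        exact hy y
    _ = _ := by
        rw [lintegral_mul_const _ hgm]
        ring

lemma eLpNorm_two_sq {d : ℕ} (u : E d → ℂ) :
    eLpNorm u 2 volume ^ 2 = ∫⁻ x, ‖u x‖ₑ ^ 2 := by
  have h := eLpNorm_nnreal_pow_eq_lintegral (μ := (volume : Measure (E d))) (f := u)
    (p := 2) two_ne_zero
  have h2 : ((2 : NNReal) : ℝ) = ((2 : ℕ) : ℝ) := by norm_num
  rw [h2] at h
  simp_rw [ENNReal.rpow_natCast] at h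
  exact_mod_cast h

/-- If `φ, m ∈ C_0^∞(ℝ^{2d})` and the matrix `∇_ξ(∇_η - ∇_ξ)φ` is
invertible on `supp m`, then `‖B_λ(f,g)‖_{L^2} ≤ C |λ|^{-d/2} ‖f‖_{L^2} ‖g‖_{L^1}`. -/
theorem statement3 {d : ℕ} (φ : E d × E d → ℝ) (m : E d × E d → ℂ)
    (hφs : ContDiff ℝ (⊤ : ℕ∞) φ) (hφc : HasCompactSupport φ)
    (hms : ContDiff ℝ (⊤ : ℕ∞) m) (hmc : HasCompactSupport m)
    (hmat : ∀ p ∈ tsupport m,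
      (derMat φ p xiV (fun j => etaV j - xiV j)).det ≠ 0) :
    ∃ C : ℝ, ∀ lam : ℝ, lam ≠ 0 → ∀ f g : 𝓢(E d, ℂ),
      eLpNorm (Bop m φ lam f g) 2 volume ≤
        ENNReal.ofReal (C * |lam| ^ (-(d : ℝ) / 2)) *
          (eLpNorm (⇑f) 2 volume * eLpNorm (⇑g) 1 volume) := by
  have hL : ContDiff ℝ (⊤ : ℕ∞) (Lsub d) := (Lsub d).contDiff
  have hΦ : ContDiff ℝ (⊤ : ℕ∞) (fun q => φ (Lsub d q)) := hφs.comp hL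
  have ha : ContDiff ℝ (⊤ : ℕ∞) (fun q => m (Lsub d q)) := hms.comp hL
  have hac : HasCompactSupport (fun q => m (Lsub d q)) :=
    hmc.comp_homeomorph (Lsub d).toHomeomorph
  obtain ⟨C, hC, hH⟩ := hormander (fun q => φ (Lsub d q)) (fun q => m (Lsub d q)) hΦ ha hac
    (by
      intro q hq ω hω
      have hq' : Lsub d q ∈ tsupport m := by
        have := tsupport_comp_subset_preimage m (Lsub d).continuous hq
        exact this
      exact nondeg_transfer φ hφs q (hmat _ hq') ω hω)
  set c : ℂ := (((2 * Real.pi) ^ (-(d : ℝ) / 2) : ℝ) : ℂ) with hc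
  have hA : ‖c‖ₑ ^ 2 * 2 * C ≠ ⊤ :=
    ENNReal.mul_ne_top (ENNReal.mul_ne_top (ENNReal.pow_ne_top enorm_ne_top) (by simp)) hC
  refine ⟨Real.sqrt (‖c‖ₑ ^ 2 * 2 * C).toReal, fun lam hlam f g => ?_⟩
  have hcf := FT_contDiff f
  have hcg := FT_contDiff g
  have hTs : ContDiff ℝ (⊤ : ℕ∞) (fun q : E d × E d =>
      Complex.exp (Complex.I * ((lam * φ (Lsub d q) : ℝ) : ℂ)) * m (Lsub d q)) := by
    refine ContDiff.mul ?_ ha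
    refine (contDiff_const.mul (Complex.ofRealCLM.contDiff.comp (contDiff_const.mul hΦ))).cexp
  have hTc : HasCompactSupport (fun q : E d × E d =>
      Complex.exp (Complex.I * ((lam * φ (Lsub d q) : ℝ) : ℂ)) * m (Lsub d q)) := hac.mul_left
  obtain ⟨u, hu⟩ := partial_schwartz (fun q : E d × E d =>
      (Complex.exp (Complex.I * ((lam * φ (Lsub d q) : ℝ) : ℂ)) * m (Lsub d q)) *
        (FT (⇑f) q.2 * FT (⇑g) (q.1 - q.2)))
      (hTs.mul ((hcf.comp contDiff_snd).mul (hcg.comp (contDiff_fst.sub contDiff_snd))))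
      hTc.mul_right
  have hBop : ∀ x, Bop m φ lam f g x = FT (⇑u) (-x) :=
    Bop_eq φ m hφs hms hmc lam f g u hu
  have hfin := final_L2 _ hTs.continuous hTc (C * ENNReal.ofReal (|lam| ^ d)⁻¹)
    (fun h hh => by rw [mul_assoc]; exact hH lam hlam h hh) (FT (⇑f)) hcf.continuous g
  have hsq : eLpNorm (Bop m φ lam f g) 2 volume ^ 2 ≤
      (ENNReal.ofReal (Real.sqrt (‖c‖ₑ ^ 2 * 2 * C).toReal * |lam| ^ (-(d : ℝ) / 2)) *
          (eLpNorm (⇑f) 2 volume * eLpNorm (⇑g) 1 volume)) ^ 2 := by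
    have hl : 0 < |lam| := abs_pos.2 hlam
    rw [mul_pow, mul_pow, eLpNorm_two_sq, eLpNorm_two_sq, eLpNorm_one_eq_lintegral_enorm,
      ← FT_plancherel f]
    have h1 : ∫⁻ x, ‖Bop m φ lam f g x‖ₑ ^ 2 = ∫⁻ ζ, ‖u ζ‖ₑ ^ 2 := by
      simp_rw [hBop]
      rw [lintegral_neg_eq_self (fun x => ‖FT (⇑u) x‖ₑ ^ 2), FT_plancherel]
    rw [h1]
    simp_rw [hu]
    refine hfin.trans (le_of_eq ?_)
    congr 1
    rw [← ENNReal.ofReal_pow (by positivity), mul_pow, Real.sq_sqrt ENNReal.toReal_nonneg,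
      ENNReal.ofReal_mul ENNReal.toReal_nonneg, ENNReal.ofReal_toReal hA, ← mul_assoc]
    congr 2
    rw [← Real.rpow_natCast, ← Real.rpow_natCast, ← Real.rpow_mul hl.le, ← Real.rpow_neg hl.le]
    congr 1
    push_cast
    ring
  exact (ENNReal.pow_right_strictMono two_ne_zero).le_iff_le.1 hsq
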